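/- For every n ≥ 1 and m ≥ 3, the corona of the path P_n with the cycle C_m satisfies Z(P_n ∘ C_m) = 2n + 1 and Z_c(P_n ∘ C_m) = 3n. -/

import Mathlib

open SimpleGraph

variable {V : Type*} {α β : Type*}

/-- Vertices forced black starting from `B`. -/
inductive ZFClosure (G : SimpleGraph V) (B : Set V) : V → Prop
  | init {v : V} : v ∈ B → ZFClosure G B v
  | force {u v : V} : ZFClosure G B u → G.Adj u v →
      (∀ w, G.Adj u w → w ≠ v → ZFClosure G B w) → ZFClosure G B v

/-- `B` is a zero forcing set of `G`. -/
def IsZFS (G : SimpleGraph V) (B : Set V) : Prop := ∀ v : V, ZFClosure G B v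

/-- `B` is a connected zero forcing set of `G`. -/
def IsCZFS (G : SimpleGraph V) (B : Set V) : Prop :=
  IsZFS G B ∧ ∀ C : G.ConnectedComponent, (G.induce (B ∩ C.supp)).Connected

/-- The zero forcing number `Z(G)`. -/
noncomputable def zfNum (G : SimpleGraph V) : ℕ :=
  sInf {k | ∃ B : Set V, B.ncard = k ∧ IsZFS G B}

/-- The connected zero forcing number `Z_c(G)`. -/
noncomputable def czfNum (G : SimpleGraph V) : ℕ :=
  sInf {k | ∃ B : Set V, B.ncard = k ∧ IsCZFS G B}

/-- One step of the color change rule. -/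
def zfStep (G : SimpleGraph V) (S : Set V) : Set V :=
  S ∪ {w | ∃ b ∈ S, G.Adj b w ∧ ∀ x, G.Adj b x → x ∉ S → x = w}

/-- propagation time of `B` in `G`. -/
noncomputable def propTime (G : SimpleGraph V) (B : Set V) : ℕ :=
  sInf {t | (zfStep G)^[t] B = Set.univ}

/-- minimum connected propagation time. -/
noncomputable def minCPT (G : SimpleGraph V) : ℕ :=
  sInf {t | ∃ B : Set V, IsCZFS G B ∧ B.ncard = czfNum G ∧ propTime G B = t}

/-- maximum connected propagation time. -/
noncomputable def maxCPT (G : SimpleGraph V) : ℕ :=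
  sSup {t | ∃ B : Set V, IsCZFS G B ∧ B.ncard = czfNum G ∧ propTime G B = t}

/-- Strong product of graphs. -/
def StrongProd (G : SimpleGraph α) (H : SimpleGraph β) : SimpleGraph (α × β) :=
  SimpleGraph.fromRel (fun a b =>
    (a.1 = b.1 ∧ H.Adj a.2 b.2) ∨ (a.2 = b.2 ∧ G.Adj a.1 b.1) ∨
      (G.Adj a.1 b.1 ∧ H.Adj a.2 b.2))

/-- Corona product of graphs. -/
def Corona (G : SimpleGraph α) (H : SimpleGraph β) : SimpleGraph (α ⊕ α × β) :=
  SimpleGraph.fromRel (fun a b =>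
    match a, b with
    | .inl u, .inl v => G.Adj u v
    | .inl u, .inr (v, _) => u = v
    | .inr (u, w), .inr (v, w') => u = v ∧ H.Adj w w'
    | _, _ => False)

/-- Generalized corona. -/
def GenCorona {n : ℕ} {W : Fin n → Type*} (G : SimpleGraph (Fin n))
    (H : ∀ i, SimpleGraph (W i)) : SimpleGraph (Fin n ⊕ Σ i, W i) :=
  SimpleGraph.fromRel (fun a b =>
    match a, b with
    | .inl i, .inl j => G.Adj i j
    | .inl i, .inr ⟨j, _⟩ => i = j
    | .inr ⟨i, w⟩, .inr ⟨j, w'⟩ => ∃ h : i = j, (H j).Adj (h ▸ w) w'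
    | _, _ => False)

/-- Wheel graph with hub `none` and rim a cycle on `m` vertices. -/
def WheelGraph (m : ℕ) : SimpleGraph (Option (Fin m)) :=
  SimpleGraph.fromRel (fun a b =>
    a = none ∨ ∃ i j, a = some i ∧ b = some j ∧ (cycleGraph m).Adj i j)


section Corona

variable {G : SimpleGraph α} {H : SimpleGraph β}

@[simp] lemma corona_adj_inl_inl {u v : α} :
    (Corona G H).Adj (.inl u) (.inl v) ↔ G.Adj u v := by
  simp only [Corona, SimpleGraph.fromRel_adj, ne_eq, Sum.inl.injEq, G.adj_comm v u, or_self]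
  exact ⟨fun h => h.2, fun h => ⟨h.ne, h⟩⟩

@[simp] lemma corona_adj_inl_inr {u v : α} {w : β} :
    (Corona G H).Adj (.inl u) (.inr (v, w)) ↔ u = v := by
  simp [Corona]

@[simp] lemma corona_adj_inr_inl {u v : α} {w : β} :
    (Corona G H).Adj (.inr (v, w)) (.inl u) ↔ u = v := by
  simp [Corona]

@[simp] lemma corona_adj_inr_inr {u v : α} {w w' : β} :
    (Corona G H).Adj (.inr (u, w)) (.inr (v, w')) ↔ u = v ∧ H.Adj w w' := by
  simp only [Corona, SimpleGraph.fromRel_adj, ne_eq, Sum.inr.injEq, Prod.mk.injEq]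
  constructor
  · rintro ⟨-, h | h⟩
    · exact h
    · exact ⟨h.1.symm, h.2.symm⟩
  · exact fun h => ⟨fun h' => h.2.ne h'.2, .inl h⟩

/-- A set containing all hubs of a corona over a connected graph induces a connected subgraph. -/
lemma corona_induce_connected (hG : G.Connected) {S : Set (α ⊕ α × β)}
    (hS : ∀ i, Sum.inl i ∈ S) : ((Corona G H).induce S).Connected := by
  let φ : G →g (Corona G H).induce S :=
    { toFun := fun i => ⟨.inl i, hS i⟩
      map_rel' := fun h => by simpa using h }
  have hub : ∀ x : S, ∃ i, ((Corona G H).induce S).Reachable x (φ i) := by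
    rintro ⟨i | ⟨i, w⟩, hx⟩
    · exact ⟨i, .refl _⟩
    · refine ⟨i, SimpleGraph.Adj.reachable ?_⟩
      simp [φ]
  have := hG.nonempty
  rw [SimpleGraph.connected_iff]
  refine ⟨fun x y => ?_, ⟨φ (Classical.arbitrary α)⟩⟩
  obtain ⟨i, hi⟩ := hub x
  obtain ⟨j, hj⟩ := hub y
  exact hi.trans (((hG.preconnected i j).map φ).trans hj.symm)

lemma corona_connected (hG : G.Connected) : (Corona G H).Connected := by
  have h := corona_induce_connected (H := H) hG (S := Set.univ) (fun _ => trivial)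
  exact (SimpleGraph.induceUnivIso (Corona G H)).connected_iff.1 h

/-- A set of vertices of a corona that induces a connected subgraph and meets two different
copies of the second factor contains the hubs of both. -/
lemma inl_mem_of_induce_preconnected {S : Set (α ⊕ α × β)}
    (hS : ((Corona G H).induce S).Preconnected) {i j : α} (hij : i ≠ j) {w w' : β}
    (hi : Sum.inr (i, w) ∈ S) (hj : Sum.inr (j, w') ∈ S) : Sum.inl i ∈ S := by
  by_contra hub
  have key : ∀ x : S, Relation.ReflTransGen ((Corona G H).induce S).Adj ⟨_, hi⟩ x →
      ∃ u, x.1 = .inr (i, u) := by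
    intro x hx
    induction hx with
    | refl => exact ⟨w, rfl⟩
    | @tail y z _ hyz ih =>
      obtain ⟨u, hu⟩ := ih
      obtain ⟨z | ⟨z, u'⟩, hz⟩ := z
      · have : z = i := by simpa [hu] using hyz
        exact absurd (this ▸ hz) hub
      · have : i = z ∧ H.Adj u u' := by simpa [hu] using hyz
        exact ⟨u', by rw [this.1]⟩
  obtain ⟨u, hu⟩ := key ⟨_, hj⟩ ((SimpleGraph.reachable_iff_reflTransGen _ _).1 (hS _ _))
  simp only [Sum.inr.injEq, Prod.mk.injEq] at hu
  exact hij hu.1.symm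

end Corona

section CoronaCycle

variable {G : SimpleGraph α} {k : ℕ} {B : Set (α ⊕ α × Fin (k + 3))}

lemma Fin.self_ne_add_one (w : Fin (k + 3)) : w ≠ w + 1 := by
  simp

lemma Fin.self_ne_sub_one (w : Fin (k + 3)) : w ≠ w - 1 := by
  intro h
  have h' : w + 1 = w := by conv_lhs => rw [h, sub_add_cancel]
  simp at h'

lemma Fin.add_one_ne_sub_one (w : Fin (k + 3)) : w + 1 ≠ w - 1 := by
  intro h
  have h2 : w + (1 + 1) = w := by rw [← add_assoc, h, sub_add_cancel]
  have h3 : (1 + 1 : Fin (k + 3)) = 0 := by simpa using h2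
  have h4 := congrArg Fin.val h3
  rw [Fin.val_add] at h4
  have h5 : 2 % (k + 3) = 0 := by simpa using h4
  rw [Nat.mod_eq_of_lt (by omega)] at h5
  omega

lemma cycleGraph_adj_iff {u v : Fin (k + 3)} :
    (cycleGraph (k + 3)).Adj u v ↔ v = u + 1 ∨ v = u - 1 := by
  rw [SimpleGraph.cycleGraph_adj, sub_eq_iff_eq_add, sub_eq_iff_eq_add]
  constructor
  · rintro (h | h)
    · right; rw [h]; simp
    · left; rw [h]; exact add_comm _ _
  · rintro (h | h)
    · right; rw [h]; exact add_comm _ _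
    · left; rw [h]; simp

/-- A zero forcing set of a corona with a cycle has two vertices in every copy of the cycle. -/
lemma IsZFS.exists_two_mem (hB : IsZFS (Corona G (cycleGraph (k + 3))) B) (i : α) :
    ∃ a b, a ≠ b ∧ Sum.inr (i, a) ∈ B ∧ Sum.inr (i, b) ∈ B := by
  by_contra! hcon
  have key : ∀ x, ZFClosure (Corona G (cycleGraph (k + 3))) B x →
      ∀ w, x = .inr (i, w) → x ∈ B := by
    intro x hx
    induction hx with
    | init h => exact fun _ _ => h
    | @force u v hu huv hw ihu ihw =>
      rintro w rfl
      exfalso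
      obtain j | ⟨j, c⟩ := u
      · obtain rfl : j = i := by simpa using huv
        exact hcon _ _ (Fin.add_one_ne_sub_one w)
          (ihw (.inr (j, w + 1)) (by simp) (by simp) _ rfl)
          (ihw (.inr (j, w - 1)) (by simp)
            (by simp) _ rfl)
      · rw [corona_adj_inr_inr, cycleGraph_adj_iff] at huv
        obtain ⟨rfl, rfl | rfl⟩ := huv
        · exact hcon _ _ (Fin.self_ne_sub_one c) (ihu c rfl)
            (ihw (.inr (j, c - 1)) (by simp [cycleGraph_adj_iff])
              (by simpa using (Fin.add_one_ne_sub_one c).symm) _ rfl)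
        · exact hcon _ _ (Fin.self_ne_add_one c) (ihu c rfl)
            (ihw (.inr (j, c + 1)) (by simp [cycleGraph_adj_iff])
              (by simpa using Fin.add_one_ne_sub_one c) _ rfl)
  exact hcon 0 (0 + 1) (Fin.self_ne_add_one 0) (key _ (hB _) _ rfl) (key _ (hB _) _ rfl)

/-- A zero forcing set of a corona with a cycle contains a hub or three consecutive vertices of
a copy of the cycle. -/
lemma IsZFS.exists_inl_mem_or [Nonempty α] (hB : IsZFS (Corona G (cycleGraph (k + 3))) B) :
    (∃ i, Sum.inl i ∈ B) ∨
      ∃ i w, Sum.inr (i, w) ∈ B ∧ Sum.inr (i, w + 1) ∈ B ∧ Sum.inr (i, w - 1) ∈ B := by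
  by_contra! hcon
  obtain ⟨hub, hcyc⟩ := hcon
  have key : ∀ x, ZFClosure (Corona G (cycleGraph (k + 3))) B x → x ∈ B := by
    intro x hx
    induction hx with
    | init h => exact h
    | @force u v hu huv hw ihu ihw =>
      exfalso
      obtain j | ⟨j, c⟩ := u
      · exact hub j ihu
      · by_cases hv : v = .inl j
        · subst hv
          exact hcyc j c ihu (ihw _ (by simp [cycleGraph_adj_iff]) (by simp))
            (ihw _ (by simp [cycleGraph_adj_iff]) (by simp))
        · exact hub j (ihw _ (by simp) (Ne.symm hv))
  exact hub (Classical.arbitrary α) (key _ (hB _))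

lemma IsZFS.two_mul_card_add_one_le [Fintype α] [Nonempty α]
    (hB : IsZFS (Corona G (cycleGraph (k + 3))) B) : 2 * Fintype.card α + 1 ≤ B.ncard := by
  choose a b hab ha hb using hB.exists_two_mem
  obtain ⟨e, he, hea⟩ : ∃ e ∈ B, ∀ i, e ≠ .inr (i, a i) ∧ e ≠ .inr (i, b i) := by
    obtain ⟨i, hi⟩ | ⟨i, w, h1, h2, h3⟩ := hB.exists_inl_mem_or
    · exact ⟨_, hi, by simp⟩
    · by_contra! hcon
      have hmem : ∀ c, Sum.inr (i, c) ∈ B → c = a i ∨ c = b i := by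
        intro c hc
        obtain ⟨j, hj⟩ := hcon _ hc
        simp only [ne_eq, Sum.inr.injEq, Prod.mk.injEq] at hj
        by_cases h : i = j ∧ c = a j
        · obtain ⟨rfl, h⟩ := h
          exact .inl h
        · obtain ⟨rfl, h⟩ := hj h
          exact .inr h
      have := Fin.self_ne_add_one w
      have := Fin.self_ne_sub_one w
      have := Fin.add_one_ne_sub_one w
      grind
  let f : Option (α × Bool) → α ⊕ α × Fin (k + 3)
    | none => e
    | some (i, true) => .inr (i, a i)
    | some (i, false) => .inr (i, b i)
  have hf : Function.Injective f := by
    rintro (_ | ⟨i, _ | _⟩) (_ | ⟨j, _ | _⟩) h <;> simp only [f] at h <;> grind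
  have hfB : Set.range f ⊆ B := by
    rintro _ ⟨_ | ⟨i, _ | _⟩, rfl⟩
    exacts [he, hb i, ha i]
  calc 2 * Fintype.card α + 1 = (Set.range f).ncard := by
        rw [← Set.image_univ, Set.ncard_image_of_injective _ hf, Set.ncard_univ]
        simp [mul_comm]
    _ ≤ B.ncard := Set.ncard_le_ncard hfB

lemma IsCZFS.three_mul_card_le [Fintype α] (hG : G.Connected)
    (hB : IsCZFS (Corona G (cycleGraph (k + 3))) B) : 3 * Fintype.card α ≤ B.ncard := by
  have := hG.nonempty
  obtain hα | hα := subsingleton_or_nontrivial α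
  · have := hB.1.two_mul_card_add_one_le
    have := Fintype.card_le_one_iff_subsingleton.2 hα
    omega
  choose a b hab ha hb using hB.1.exists_two_mem
  have hub : ∀ i, Sum.inl i ∈ B := by
    intro i
    obtain ⟨j, hj⟩ := exists_ne i
    let C := (Corona G (cycleGraph (k + 3))).connectedComponentMk (.inl i)
    have hC : ∀ x, x ∈ C.supp := fun x =>
      SimpleGraph.ConnectedComponent.sound ((corona_connected hG).preconnected _ _)
    exact (inl_mem_of_induce_preconnected (hB.2 C).preconnected hj.symm
      ⟨ha i, hC _⟩ ⟨ha j, hC _⟩).1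
  let f : α × Option Bool → α ⊕ α × Fin (k + 3)
    | (i, none) => .inl i
    | (i, some true) => .inr (i, a i)
    | (i, some false) => .inr (i, b i)
  have hf : Function.Injective f := by
    rintro ⟨i, _ | _ | _⟩ ⟨j, _ | _ | _⟩ h <;> simp only [f] at h <;> grind
  have hfB : Set.range f ⊆ B := by
    rintro _ ⟨⟨i, _ | _ | _⟩, rfl⟩
    exacts [hub i, hb i, ha i]
  calc 3 * Fintype.card α = (Set.range f).ncard := by
        rw [← Set.image_univ, Set.ncard_image_of_injective _ hf, Set.ncard_univ]
        simp [mul_comm]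
    _ ≤ B.ncard := Set.ncard_le_ncard hfB

open Fin.CommRing in
/-- Once a hub and two adjacent vertices of its cycle are black, the whole cycle is forced. -/
lemma ZFClosure.inr_of_hub {i : α}
    (hub : ZFClosure (Corona G (cycleGraph (k + 3))) B (.inl i))
    (h0 : ZFClosure (Corona G (cycleGraph (k + 3))) B (.inr (i, 0)))
    (h1 : ZFClosure (Corona G (cycleGraph (k + 3))) B (.inr (i, 1))) (w : Fin (k + 3)) :
    ZFClosure (Corona G (cycleGraph (k + 3))) B (.inr (i, w)) := by
  have key : ∀ j : ℕ, ZFClosure (Corona G (cycleGraph (k + 3))) B (.inr (i, (j : Fin (k + 3)))) ∧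
      ZFClosure (Corona G (cycleGraph (k + 3))) B (.inr (i, (j : Fin (k + 3)) + 1)) := by
    intro j
    induction j with
    | zero => simpa using ⟨h0, h1⟩
    | succ j ih =>
      rw [Nat.cast_succ]
      refine ⟨ih.2, .force ih.2 (by simp [cycleGraph_adj_iff]) ?_⟩
      rintro (l | ⟨l, c⟩) hadj hne
      · obtain rfl : l = i := by simpa using hadj
        exact hub
      · rw [corona_adj_inr_inr, cycleGraph_adj_iff] at hadj
        obtain ⟨rfl, rfl | rfl⟩ := hadj
        · exact absurd rfl hne
        · simpa using ih.1
  simpa using (key w.val).1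

end CoronaCycle

lemma isZFS_corona_pathGraph {n k : ℕ} {B : Set (Fin n ⊕ Fin n × Fin (k + 3))}
    (hub : ∀ i : Fin n, i.val = 0 → Sum.inl i ∈ B)
    (h0 : ∀ i, Sum.inr (i, 0) ∈ B) (h1 : ∀ i, Sum.inr (i, 1) ∈ B) :
    IsZFS (Corona (pathGraph n) (cycleGraph (k + 3))) B := by
  have cyc (i) (hi : ZFClosure (Corona (pathGraph n) (cycleGraph (k + 3))) B (.inl i)) (w) :=
    ZFClosure.inr_of_hub hi (.init (h0 i)) (.init (h1 i)) w
  have hubs : ∀ (j : ℕ) (hj : j < n),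
      ZFClosure (Corona (pathGraph n) (cycleGraph (k + 3))) B (.inl ⟨j, hj⟩) := by
    intro j
    induction j using Nat.strong_induction_on with
    | _ j ih =>
      intro hj
      obtain _ | j := j
      · exact .init (hub _ rfl)
      · have hj' := ih j (by omega) (by omega)
        refine .force hj' (by simp [SimpleGraph.pathGraph_adj]) ?_
        rintro (l | ⟨l, c⟩) hadj hne
        · rw [corona_adj_inl_inl, SimpleGraph.pathGraph_adj] at hadj
          simp only [ne_eq, Sum.inl.injEq, Fin.ext_iff] at hadj hne
          exact ih l.val (by omega) l.isLt
        · obtain rfl : _ = l := by simpa using hadj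
          exact cyc _ hj' c
  rintro (i | ⟨i, w⟩)
  · exact hubs i.val i.isLt
  · exact cyc i (hubs i.val i.isLt) w

lemma zfNum_corona_pathGraph_le (n k : ℕ) :
    zfNum (Corona (pathGraph (n + 1)) (cycleGraph (k + 3))) ≤ 2 * (n + 1) + 1 := by
  let f : Option (Fin (n + 1) × Bool) → Fin (n + 1) ⊕ Fin (n + 1) × Fin (k + 3)
    | none => .inl 0
    | some (i, true) => .inr (i, 1)
    | some (i, false) => .inr (i, 0)
  have hB : IsZFS (Corona (pathGraph (n + 1)) (cycleGraph (k + 3))) (Set.range f) := by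
    refine isZFS_corona_pathGraph (fun i hi => ⟨none, ?_⟩)
      (fun i => ⟨some (i, false), rfl⟩) (fun i => ⟨some (i, true), rfl⟩)
    obtain rfl : i = 0 := Fin.ext hi
    rfl
  refine le_trans (Nat.sInf_le ⟨Set.range f, rfl, hB⟩) ?_
  rw [← Set.image_univ]
  refine (Set.ncard_image_le Set.finite_univ).trans ?_
  simp [Set.ncard_univ, mul_comm]

lemma czfNum_corona_pathGraph_le (n k : ℕ) :
    czfNum (Corona (pathGraph (n + 1)) (cycleGraph (k + 3))) ≤ 3 * (n + 1) := by
  let f : Fin (n + 1) × Option Bool → Fin (n + 1) ⊕ Fin (n + 1) × Fin (k + 3)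
    | (i, none) => .inl i
    | (i, some true) => .inr (i, 1)
    | (i, some false) => .inr (i, 0)
  have hG : (pathGraph (n + 1)).Connected := SimpleGraph.pathGraph_connected n
  have hB : IsCZFS (Corona (pathGraph (n + 1)) (cycleGraph (k + 3))) (Set.range f) := by
    refine ⟨isZFS_corona_pathGraph (fun i _ => ⟨(i, none), rfl⟩)
      (fun i => ⟨(i, some false), rfl⟩) (fun i => ⟨(i, some true), rfl⟩), fun C => ?_⟩
    refine corona_induce_connected hG fun i => ⟨⟨(i, none), rfl⟩, ?_⟩
    induction C using SimpleGraph.ConnectedComponent.ind with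
    | _ v => exact SimpleGraph.ConnectedComponent.sound ((corona_connected hG).preconnected _ _)
  refine le_trans (Nat.sInf_le ⟨Set.range f, rfl, hB⟩) ?_
  rw [← Set.image_univ]
  refine (Set.ncard_image_le Set.finite_univ).trans ?_
  simp [Set.ncard_univ, mul_comm]

/-- `Z(P_n ∘ C_m) = 2n + 1` and `Z_c(P_n ∘ C_m) = 3n` for `n ≥ 1`, `m ≥ 3`. -/
theorem stmt16 (n m : ℕ) (hn : 1 ≤ n) (hm : 3 ≤ m) :
    zfNum (Corona (pathGraph n) (cycleGraph m)) = 2 * n + 1 ∧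
      czfNum (Corona (pathGraph n) (cycleGraph m)) = 3 * n := by
  obtain ⟨n, rfl⟩ := Nat.exists_eq_add_of_le' hn
  obtain ⟨k, rfl⟩ := Nat.exists_eq_add_of_le' hm
  refine ⟨(zfNum_corona_pathGraph_le n k).antisymm ?_,
    (czfNum_corona_pathGraph_le n k).antisymm ?_⟩
  · refine le_csInf ⟨_, Set.univ, rfl, fun v => .init trivial⟩ ?_
    rintro _ ⟨B, rfl, hB⟩
    simpa using hB.two_mul_card_add_one_le
  · have hG : (pathGraph (n + 1)).Connected := SimpleGraph.pathGraph_connected n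
    refine le_csInf ⟨_, Set.univ, rfl, fun v => .init trivial, fun C => ?_⟩ ?_
    · rw [Set.univ_inter]
      exact C.connected_toSimpleGraph
    · rintro _ ⟨B, rfl, hB⟩
      simpa using hB.three_mul_card_le hG
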